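/- arXiv:2404.02325 — 5 statements merged into one kernel-verified Lean document; each statement's English description precedes it below -/
import Mathlib

section
/- Let θ ∈ Δⁿ and let I ⊆ {1,…,n} be an index set such that min_{i∈I} θᵢ > 0 and max_{i∈I} θᵢ > min_{i∈I} θᵢ. Then the function T ↦ V_I(τ_T(θ)) is strictly decreasing on (0, ∞). -/
open scoped BigOperators

/-- The probability simplex `Δⁿ = {x ∈ ℝⁿ : xᵢ ≥ 0, ∑ᵢ xᵢ = 1}`. -/
def simplex (n : ℕ) : Set (Fin n → ℝ) := {x | (∀ i, 0 ≤ x i) ∧ ∑ i, x i = 1}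

/-- The softmax-temperature map `τ_T(θ)ᵢ = θᵢ^{1/T} / ∑ⱼ θⱼ^{1/T}`
(with the convention `0^{1/T} = 0`, which holds for `Real.rpow` since `1/T ≠ 0`). -/
noncomputable def tauT {n : ℕ} (T : ℝ) (θ : Fin n → ℝ) : Fin n → ℝ :=
  fun i => θ i ^ (1 / T) / ∑ j, θ j ^ (1 / T)

/-- The Lyapunov function
`V_I(θ) = max_{i∈I} θᵢ/∑_{j∈I} θⱼ − min_{i∈I} θᵢ/∑_{j∈I} θⱼ` for a nonempty index set `I`. -/
noncomputable def VI {n : ℕ} (I : Finset (Fin n)) (hI : I.Nonempty) (θ : Fin n → ℝ) : ℝ :=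
  (I.sup' hI fun i => θ i / ∑ j ∈ I, θ j) - (I.inf' hI fun i => θ i / ∑ j ∈ I, θ j)

/-- Cross-multiplied monotonicity of `s ↦ (b / a) ^ s` for `a ≤ b`. -/
theorem rpow_mul_rpow_le_rpow_mul_rpow {a b s t : ℝ} (ha : 0 < a) (hab : a ≤ b) (hst : s ≤ t) :
    a ^ t * b ^ s ≤ a ^ s * b ^ t := by
  have hb := ha.trans_le hab
  obtain ⟨d, rfl⟩ := exists_add_of_le hst
  have hd : 0 ≤ d := by linarith
  rw [Real.rpow_add ha, Real.rpow_add hb]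
  calc a ^ s * a ^ d * b ^ s = a ^ s * b ^ s * a ^ d := by ring
    _ ≤ a ^ s * b ^ s * b ^ d := by gcongr
    _ = a ^ s * (b ^ s * b ^ d) := by ring

theorem rpow_mul_rpow_lt_rpow_mul_rpow {a b s t : ℝ} (ha : 0 < a) (hab : a < b) (hst : s < t) :
    a ^ t * b ^ s < a ^ s * b ^ t := by
  have hb := ha.trans hab
  obtain ⟨d, rfl⟩ := exists_add_of_le hst.le
  have hd : 0 < d := by linarith
  rw [Real.rpow_add ha, Real.rpow_add hb]
  calc a ^ s * a ^ d * b ^ s = a ^ s * b ^ s * a ^ d := by ring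
    _ < a ^ s * b ^ s * b ^ d := by gcongr
    _ = a ^ s * (b ^ s * b ^ d) := by ring

/-- The share of a largest coordinate is nondecreasing in the exponent. -/
theorem rpow_div_sum_rpow_le_of_isMax {ι : Type*} {I : Finset ι} {θ : ι → ℝ} {p : ι} (hp : p ∈ I)
    (hpos : ∀ j ∈ I, 0 < θ j) (hmax : ∀ j ∈ I, θ j ≤ θ p) {s t : ℝ} (hst : s ≤ t) :
    θ p ^ s / ∑ j ∈ I, θ j ^ s ≤ θ p ^ t / ∑ j ∈ I, θ j ^ t := by
  have hS (r : ℝ) : 0 < ∑ j ∈ I, θ j ^ r :=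
    Finset.sum_pos (fun j hj => Real.rpow_pos_of_pos (hpos j hj) r) ⟨p, hp⟩
  rw [div_le_div_iff₀ (hS s) (hS t), Finset.mul_sum, Finset.mul_sum]
  refine Finset.sum_le_sum fun j hj => ?_
  linarith [rpow_mul_rpow_le_rpow_mul_rpow (hpos j hj) (hmax j hj) hst]

/-- The share of a smallest coordinate is strictly decreasing in the exponent, unless all
coordinates agree. -/
theorem rpow_div_sum_rpow_lt_of_isMin {ι : Type*} {I : Finset ι} {θ : ι → ℝ} {p q : ι} (hp : p ∈ I)
    (hpos : ∀ j ∈ I, 0 < θ j) (hmin : ∀ j ∈ I, θ p ≤ θ j) (hq : q ∈ I) (hpq : θ p < θ q)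
    {s t : ℝ} (hst : s < t) :
    θ p ^ t / ∑ j ∈ I, θ j ^ t < θ p ^ s / ∑ j ∈ I, θ j ^ s := by
  have hS (r : ℝ) : 0 < ∑ j ∈ I, θ j ^ r :=
    Finset.sum_pos (fun j hj => Real.rpow_pos_of_pos (hpos j hj) r) ⟨p, hp⟩
  rw [div_lt_div_iff₀ (hS t) (hS s), Finset.mul_sum, Finset.mul_sum]
  exact Finset.sum_lt_sum
    (fun j hj => rpow_mul_rpow_le_rpow_mul_rpow (hpos p hp) (hmin j hj) hst.le)
    ⟨q, hq, rpow_mul_rpow_lt_rpow_mul_rpow (hpos p hp) hpq hst⟩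

theorem VI_tauT_eq {n : ℕ} {θ : Fin n → ℝ} (hθ : ∀ i, 0 ≤ θ i) {I : Finset (Fin n)}
    (hI : I.Nonempty) (hpos : ∀ j ∈ I, 0 < θ j) {p q : Fin n} (hp : p ∈ I) (hq : q ∈ I)
    (hmin : ∀ j ∈ I, θ p ≤ θ j) (hmax : ∀ j ∈ I, θ j ≤ θ q) {T : ℝ} (hT : 0 < T) :
    VI I hI (tauT T θ) =
      θ q ^ (1 / T) / ∑ j ∈ I, θ j ^ (1 / T) - θ p ^ (1 / T) / ∑ j ∈ I, θ j ^ (1 / T) := by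
  have hS : 0 < ∑ j ∈ I, θ j ^ (1 / T) :=
    Finset.sum_pos (fun j hj => Real.rpow_pos_of_pos (hpos j hj) _) hI
  have hZ : 0 < ∑ j, θ j ^ (1 / T) :=
    Finset.sum_pos' (fun j _ => Real.rpow_nonneg (hθ j) _)
      ⟨p, Finset.mem_univ p, Real.rpow_pos_of_pos (hpos p hp) _⟩
  have hshare (i : Fin n) : tauT T θ i / ∑ j ∈ I, tauT T θ j =
      θ i ^ (1 / T) / ∑ j ∈ I, θ j ^ (1 / T) := by
    simp only [tauT]
    rw [← Finset.sum_div, div_div_div_cancel_right₀ hZ.ne']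
  have hle {i j : Fin n} (h : θ i ≤ θ j) : θ i ^ (1 / T) / ∑ j ∈ I, θ j ^ (1 / T) ≤
      θ j ^ (1 / T) / ∑ j ∈ I, θ j ^ (1 / T) :=
    div_le_div_of_nonneg_right (Real.rpow_le_rpow (hθ i) h (by positivity)) hS.le
  simp only [VI, hshare]
  congr 1
  · exact le_antisymm (Finset.sup'_le _ _ fun j hj => hle (hmax j hj))
      (Finset.le_sup' (fun i => θ i ^ (1 / T) / ∑ j ∈ I, θ j ^ (1 / T)) hq)
  · exact le_antisymm (Finset.inf'_le (fun i => θ i ^ (1 / T) / ∑ j ∈ I, θ j ^ (1 / T)) hp)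
      (Finset.le_inf' _ _ fun j hj => hle (hmin j hj))

/-- If `θ ∈ Δⁿ` and `I` is an index set with `min_{i∈I} θᵢ > 0` and
`max_{i∈I} θᵢ > min_{i∈I} θᵢ`, then `T ↦ V_I(τ_T(θ))` is strictly decreasing on `(0, ∞)`. -/
theorem VI_tauT_strictAntiOn {n : ℕ} (θ : Fin n → ℝ) (hθ : θ ∈ simplex n)
    (I : Finset (Fin n)) (hI : I.Nonempty)
    (hmin : 0 < I.inf' hI θ) (hlt : I.inf' hI θ < I.sup' hI θ) :
    StrictAntiOn (fun T : ℝ => VI I hI (tauT T θ)) (Set.Ioi (0 : ℝ)) := by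
  obtain ⟨p, hp, hp_eq⟩ := Finset.exists_mem_eq_inf' hI θ
  obtain ⟨q, hq, hq_eq⟩ := Finset.exists_mem_eq_sup' hI θ
  have hinf : ∀ j ∈ I, θ p ≤ θ j := fun j hj => hp_eq ▸ Finset.inf'_le θ hj
  have hsup : ∀ j ∈ I, θ j ≤ θ q := fun j hj => hq_eq ▸ Finset.le_sup' θ hj
  rw [hp_eq] at hmin hlt
  rw [hq_eq] at hlt
  have hpos : ∀ j ∈ I, 0 < θ j := fun j hj => hmin.trans_le (hinf j hj)
  intro S hS T hT hST
  have hexp : 1 / T < 1 / S := one_div_lt_one_div_of_lt hS hST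
  simp only [VI_tauT_eq hθ.1 hI hpos hp hq hinf hsup hS,
    VI_tauT_eq hθ.1 hI hpos hp hq hinf hsup hT]
  linarith [rpow_div_sum_rpow_le_of_isMax hq hpos hsup hexp.le,
    rpow_div_sum_rpow_lt_of_isMin hp hpos hinf hq hlt hexp]
end

section
/- Let T > 1, let θ ∈ Δⁿ, and let I ⊆ {1,…,n} be an index set such that min_{i∈I} θᵢ > 0 and max_{i∈I} θᵢ > min_{i∈I} θᵢ. Then V_I(τ_T(θ)) < V_I(θ); i.e., for T > 1 the softmax-temperature map τ_T is contractive. -/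
open scoped BigOperators

theorem rpow_mul_lt_mul_rpow_of_lt {p u v : ℝ} (hp : p < 1) (hv : 0 < v) (hvu : v < u) :
    u ^ p * v < u * v ^ p := by
  have hu : 0 < u := hv.trans hvu
  have split : ∀ x : ℝ, 0 < x → x = x ^ p * x ^ (1 - p) := fun x hx => by
    rw [← Real.rpow_add hx, add_sub_cancel, Real.rpow_one]
  have h : v ^ (1 - p) < u ^ (1 - p) := Real.rpow_lt_rpow hv.le hvu (by linarith)
  calc u ^ p * v = u ^ p * v ^ p * v ^ (1 - p) := by rw [mul_assoc, ← split v hv]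
    _ < u ^ p * v ^ p * u ^ (1 - p) := by gcongr
    _ = u * v ^ p := by rw [mul_right_comm, ← split u hu]

theorem rpow_mul_le_mul_rpow_of_le {p u v : ℝ} (hp : p < 1) (hv : 0 < v) (hvu : v ≤ u) :
    u ^ p * v ≤ u * v ^ p := by
  rcases hvu.eq_or_lt with rfl | h
  · rw [mul_comm]
  · exact (rpow_mul_lt_mul_rpow_of_lt hp hv h).le

theorem tauT_div_sum_tauT {n : ℕ} {T : ℝ} {θ : Fin n → ℝ} (I : Finset (Fin n))
    (hS : ∑ j, θ j ^ (1 / T) ≠ 0) (i : Fin n) :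
    tauT T θ i / ∑ j ∈ I, tauT T θ j = θ i ^ (1 / T) / ∑ j ∈ I, θ j ^ (1 / T) := by
  simp only [tauT]
  rw [← Finset.sum_div, div_div_div_cancel_right₀ hS]

/-- High temperature is contractive: for `T > 1`, `θ ∈ Δⁿ` and an index set `I` with
`min_{i∈I} θᵢ > 0` and `max_{i∈I} θᵢ > min_{i∈I} θᵢ`, we have `V_I(τ_T(θ)) < V_I(θ)`. -/
theorem VI_tauT_lt_of_one_lt_temp {n : ℕ} (T : ℝ) (hT : 1 < T)
    (θ : Fin n → ℝ) (hθ : θ ∈ simplex n)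
    (I : Finset (Fin n)) (hI : I.Nonempty)
    (hmin : 0 < I.inf' hI θ) (hlt : I.inf' hI θ < I.sup' hI θ) :
    VI I hI (tauT T θ) < VI I hI θ := by
  have hpos : ∀ i ∈ I, 0 < θ i := fun i hi => hmin.trans_le (Finset.inf'_le θ hi)
  obtain ⟨a, ha, hsup⟩ := Finset.exists_mem_eq_sup' hI θ
  obtain ⟨b, hb, hinf⟩ := Finset.exists_mem_eq_inf' hI θ
  have hle_a : ∀ i ∈ I, θ i ≤ θ a := fun i hi => hsup ▸ Finset.le_sup' θ hi
  have hb_le : ∀ i ∈ I, θ b ≤ θ i := fun i hi => hinf ▸ Finset.inf'_le θ hi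
  have hba : θ b < θ a := by rwa [hsup, hinf] at hlt
  have hp0 : 0 < 1 / T := by positivity
  have hp1 : 1 / T < 1 := (div_lt_one (by linarith)).2 hT
  have hS : ∑ j, θ j ^ (1 / T) ≠ 0 :=
    (Finset.sum_pos' (fun j _ => Real.rpow_nonneg (hθ.1 j) _)
      ⟨a, Finset.mem_univ a, Real.rpow_pos_of_pos (hpos a ha) _⟩).ne'
  have hY : 0 < ∑ j ∈ I, θ j ^ (1 / T) :=
    Finset.sum_pos (fun j hj => Real.rpow_pos_of_pos (hpos j hj) _) hI
  have hX : 0 < ∑ j ∈ I, θ j := Finset.sum_pos hpos hI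
  simp only [VI, tauT_div_sum_tauT I hS]
  apply (sub_lt_sub_right ?_ _).trans_le (sub_le_sub_left ?_ _)
  · refine (Finset.sup'_lt_iff hI).2 fun i hi => ?_
    calc θ i ^ (1 / T) / ∑ j ∈ I, θ j ^ (1 / T)
        ≤ θ a ^ (1 / T) / ∑ j ∈ I, θ j ^ (1 / T) := by
          gcongr
          exacts [(hpos i hi).le, hle_a i hi]
      _ < θ a / ∑ j ∈ I, θ j := by
          rw [div_lt_div_iff₀ hY hX, Finset.mul_sum, Finset.mul_sum]
          exact Finset.sum_lt_sum
            (fun j hj => rpow_mul_le_mul_rpow_of_le hp1 (hpos j hj) (hle_a j hj))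
            ⟨b, hb, rpow_mul_lt_mul_rpow_of_lt hp1 (hpos b hb) hba⟩
      _ ≤ _ := Finset.le_sup' (fun i => θ i / ∑ j ∈ I, θ j) ha
  · refine Finset.le_inf' hI _ fun i hi => ?_
    calc _ ≤ θ b / ∑ j ∈ I, θ j := Finset.inf'_le (fun i => θ i / ∑ j ∈ I, θ j) hb
      _ ≤ θ b ^ (1 / T) / ∑ j ∈ I, θ j ^ (1 / T) := by
          rw [div_le_div_iff₀ hX hY, Finset.mul_sum, Finset.mul_sum]
          refine Finset.sum_le_sum fun j hj => ?_
          have := rpow_mul_le_mul_rpow_of_le hp1 (hpos b hb) (hb_le j hj)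
          linarith
      _ ≤ θ i ^ (1 / T) / ∑ j ∈ I, θ j ^ (1 / T) := by
          gcongr
          exacts [(hpos b hb).le, hb_le i hi]
end

section
/- Let (Ω, F, P) be a probability space with filtration (F_k)_{k≥ℓ}, let δ ≥ 0, and let Θ* be an adapted ℝⁿ-valued process satisfying, for all k ≥ ℓ, Θ*(k+1) = Θ*(k) + (1/(k+1))·(U(k+1) + ε(k)), where each U(k+1) is a bounded F_{k+1}-measurable random vector with E[U(k+1) | F_k] = 0 and each ε(k) is a bounded F_k-measurable random vector. Suppose also that Θ is an adapted ℝⁿ-valued process with ‖Θ(k) − Θ*(k)‖ ≤ δ almost surely for all k ≥ ℓ. Then, almost surely, for all k ≥ ℓ: ‖E[Θ(k+1) | F_ℓ] − Θ(ℓ) − Σ_{i=ℓ}^{k} (1/(i+1))·E[ε(i) | F_ℓ]‖ ≤ 2δ. -/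
open scoped BigOperators
open MeasureTheory

namespace MeasureTheory

variable {α E : Type*} {m m₀ : MeasurableSpace α} {μ : Measure α}
  [NormedAddCommGroup E] [NormedSpace ℝ E] [CompleteSpace E]

/-- A function centred conditionally on a σ-algebra is so on every coarser one. -/
theorem condExp_ae_eq_zero_of_le {m' : MeasurableSpace α} [IsFiniteMeasure μ] {f : α → E}
    (hmm' : m ≤ m') (hm' : m' ≤ m₀) (hf : μ[f | m'] =ᵐ[μ] 0) : μ[f | m] =ᵐ[μ] 0 := by
  have h := condExp_congr_ae (m := m) hf
  rw [condExp_zero] at h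
  exact (condExp_condExp_of_le hmm' hm').symm.trans h

end MeasureTheory

section Recursion

variable {Ω E : Type*} {m₀ : MeasurableSpace Ω} {μ : Measure Ω}
  [NormedAddCommGroup E] [NormedSpace ℝ E] {ℱ : Filtration ℕ m₀} {ℓ : ℕ}
  {X U ε : ℕ → Ω → E} {c : ℕ → ℝ}

theorem integrable_of_recursion (hX : Integrable (X ℓ) μ)
    (hU : ∀ k ≥ ℓ, Integrable (U (k + 1)) μ) (hε : ∀ k ≥ ℓ, Integrable (ε k) μ)
    (hrec : ∀ k ≥ ℓ, X (k + 1) = X k + c k • (U (k + 1) + ε k)) :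
    ∀ k ≥ ℓ, Integrable (X k) μ := by
  intro k hk
  induction k, hk using Nat.le_induction with
  | base => exact hX
  | succ k hk ih =>
    rw [hrec k hk]
    exact ih.add (((hU k hk).add (hε k hk)).smul (c k))

/-- Conditioning a recursion driven by martingale differences `U` and a drift `ε` on its initial
σ-algebra leaves only the conditional expectation of the accumulated drift. -/
theorem condExp_recursion_ae_eq [IsFiniteMeasure μ] [CompleteSpace E]
    (hXm : StronglyMeasurable[ℱ ℓ] (X ℓ))
    (hX : Integrable (X ℓ) μ)
    (hU : ∀ k ≥ ℓ, Integrable (U (k + 1)) μ) (hε : ∀ k ≥ ℓ, Integrable (ε k) μ)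
    (hU0 : ∀ k ≥ ℓ, μ[U (k + 1) | ℱ k] =ᵐ[μ] 0)
    (hrec : ∀ k ≥ ℓ, X (k + 1) = X k + c k • (U (k + 1) + ε k)) :
    ∀ k ≥ ℓ, ∀ᵐ ω ∂μ, (μ[X (k + 1) | ℱ ℓ]) ω =
      X ℓ ω + ∑ i ∈ Finset.Icc ℓ k, c i • (μ[ε i | ℱ ℓ]) ω := by
  have hstep : ∀ k ≥ ℓ, ∀ᵐ ω ∂μ, (μ[X (k + 1) | ℱ ℓ]) ω =
      (μ[X k | ℱ ℓ]) ω + c k • (μ[ε k | ℱ ℓ]) ω := by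
    intro k hk
    rw [hrec k hk]
    filter_upwards [condExp_add (integrable_of_recursion hX hU hε hrec k hk)
        (((hU k hk).add (hε k hk)).smul (c k)) (ℱ ℓ),
      condExp_smul (μ := μ) (c k) (U (k + 1) + ε k) (ℱ ℓ),
      condExp_add (hU k hk) (hε k hk) (ℱ ℓ),
      condExp_ae_eq_zero_of_le (ℱ.mono hk) (ℱ.le k) (hU0 k hk)] with ω h₁ h₂ h₃ h₄
    simp only [Pi.add_apply, Pi.smul_apply, Pi.zero_apply] at h₁ h₂ h₃ h₄
    rw [h₁, h₂, h₃, h₄, zero_add]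
  intro k hk
  induction k, hk using Nat.le_induction with
  | base =>
    filter_upwards [hstep ℓ le_rfl] with ω h
    rw [h, condExp_of_stronglyMeasurable (ℱ.le ℓ) hXm hX, Finset.Icc_self, Finset.sum_singleton]
  | succ k hk ih =>
    filter_upwards [ih, hstep (k + 1) (hk.trans k.le_succ)] with ω h₁ h₂
    rw [h₂, h₁, Finset.sum_Icc_succ_top (hk.trans k.le_succ), add_assoc]

end Recursion

/-- For the identity-temperature closed-loop learning recursion
`Θ*(k+1) = Θ*(k) + (1/(k+1))·(U(k+1) + ε(k))`, if the model distribution `Θ` stays within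
`δ` of the empirical distribution `Θ*`, then almost surely, for all `k ≥ ℓ`,
`‖E[Θ(k+1) | F_ℓ] − Θ(ℓ) − ∑_{i=ℓ}^k (1/(i+1))·E[ε(i) | F_ℓ]‖ ≤ 2δ`. -/
theorem identity_temperature_condexp_model {n ℓ : ℕ}
    {Ωs : Type*} {m0 : MeasurableSpace Ωs} (μ : Measure Ωs) [IsProbabilityMeasure μ]
    (ℱ : Filtration ℕ m0) (δ : ℝ) (hδ0 : 0 ≤ δ)
    (Θstar Θ U ε : ℕ → Ωs → EuclideanSpace ℝ (Fin n))
    -- `Θ*` is adapted and (initially) integrable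
    (hadapt : ∀ k ≥ ℓ, Measurable[ℱ k] (Θstar k))
    (hint : Integrable (Θstar ℓ) μ)
    -- the recursion
    (hrec : ∀ k ≥ ℓ, ∀ ω,
      Θstar (k + 1) ω = Θstar k ω + ((k : ℝ) + 1)⁻¹ • (U (k + 1) ω + ε k ω))
    -- `U` is a bounded martingale difference sequence
    (hUmeas : ∀ k ≥ ℓ, Measurable[ℱ (k + 1)] (U (k + 1)))
    (hUbdd : ∀ k ≥ ℓ, ∃ C : ℝ, ∀ ω, ‖U (k + 1) ω‖ ≤ C)
    (hUmart : ∀ k ≥ ℓ, μ[U (k + 1) | ℱ k] =ᵐ[μ] 0)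
    -- `ε` is bounded and adapted
    (hεmeas : ∀ k ≥ ℓ, Measurable[ℱ k] (ε k))
    (hεbdd : ∀ k ≥ ℓ, ∃ C : ℝ, ∀ ω, ‖ε k ω‖ ≤ C)
    -- `Θ` is adapted and within `δ` of `Θ*` almost surely
    (hΘmeas : ∀ k ≥ ℓ, Measurable[ℱ k] (Θ k))
    (hΘδ : ∀ k ≥ ℓ, ∀ᵐ ω ∂μ, ‖Θ k ω - Θstar k ω‖ ≤ δ) :
    ∀ k ≥ ℓ, ∀ᵐ ω ∂μ,
      ‖(μ[Θ (k + 1) | ℱ ℓ]) ω - Θ ℓ ω -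
          ∑ i ∈ Finset.Icc ℓ k, ((i : ℝ) + 1)⁻¹ • (μ[ε i | ℱ ℓ]) ω‖ ≤ 2 * δ := by
  have integrable_of_bdd : ∀ {j : ℕ} {f : Ωs → EuclideanSpace ℝ (Fin n)},
      Measurable[ℱ j] f → (∃ C : ℝ, ∀ ω, ‖f ω‖ ≤ C) → Integrable f μ := by
    rintro j f hf ⟨C, hC⟩
    exact .of_bound (hf.mono (ℱ.le j) le_rfl).aestronglyMeasurable C (.of_forall hC)
  have hU k (hk : k ≥ ℓ) := integrable_of_bdd (hUmeas k hk) (hUbdd k hk)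
  have hε k (hk : k ≥ ℓ) := integrable_of_bdd (hεmeas k hk) (hεbdd k hk)
  have hrec' : ∀ k ≥ ℓ, Θstar (k + 1) = Θstar k + ((k : ℝ) + 1)⁻¹ • (U (k + 1) + ε k) :=
    fun k hk ↦ funext (hrec k hk)
  intro k hk
  have hk' : k + 1 ≥ ℓ := hk.trans k.le_succ
  have hstar := integrable_of_recursion (c := fun k ↦ ((k : ℝ) + 1)⁻¹) hint hU hε hrec' (k + 1) hk'
  have hdiff : Integrable (Θ (k + 1) - Θstar (k + 1)) μ :=
    .of_bound (((hΘmeas _ hk').mono (ℱ.le _) le_rfl).sub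
      ((hadapt _ hk').mono (ℱ.le _) le_rfl)).aestronglyMeasurable δ (hΘδ _ hk')
  have hΘ : Integrable (Θ (k + 1)) μ := by simpa using hdiff.add hstar
  have hbound : ∀ᵐ ω ∂μ, ‖(μ[Θ (k + 1) - Θstar (k + 1) | ℱ ℓ]) ω‖ ≤ δ :=
    ae_bdd_norm_condExp_of_ae_bdd_norm (hΘδ _ hk')
  filter_upwards [hbound, condExp_sub hΘ hstar (ℱ ℓ), hΘδ ℓ le_rfl,
    condExp_recursion_ae_eq (c := fun k ↦ ((k : ℝ) + 1)⁻¹) (hadapt ℓ le_rfl).stronglyMeasurable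
      hint hU hε hUmart hrec' k hk] with ω h₁ h₂ h₃ h₄
  rw [h₂, Pi.sub_apply, h₄] at h₁
  calc _ = ‖((μ[Θ (k + 1) | ℱ ℓ]) ω -
          (Θstar ℓ ω + ∑ i ∈ Finset.Icc ℓ k, ((i : ℝ) + 1)⁻¹ • (μ[ε i | ℱ ℓ]) ω)) -
          (Θ ℓ ω - Θstar ℓ ω)‖ := by congr 1; abel
    _ ≤ 2 * δ := (norm_sub_le_of_le h₁ h₃).trans_eq (two_mul δ).symm
end

section
/- Let τ : Δⁿ → Δⁿ be continuous, order preserving and contractive, let I ⊆ {1,…,n} be a nonempty index set, and for a > 0 define B(a) = Δⁿ \ (Ω̲_I(a) ∪ Ω̄_I(a)). If B(a) is nonempty, then sup over θ in the closure of B(a) of (V_I(τ(θ)) − V_I(θ)) is strictly negative. -/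
open scoped BigOperators

/-- `Ω̲_I(a) = {θ ∈ Δⁿ : V_I(θ) ≤ a}`, a neighborhood of the conditional uniform vector. -/
noncomputable def OmegaLow {n : ℕ} (I : Finset (Fin n)) (hI : I.Nonempty) (a : ℝ) :
    Set (Fin n → ℝ) :=
  {θ ∈ simplex n | VI I hI θ ≤ a}

/-- `Ω̄_I(a) = {θ ∈ Δⁿ : min_{i∈I} θᵢ ≤ a}`, a neighborhood of the simplex boundary. -/
noncomputable def OmegaHigh {n : ℕ} (I : Finset (Fin n)) (hI : I.Nonempty) (a : ℝ) :
    Set (Fin n → ℝ) :=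
  {θ ∈ simplex n | I.inf' hI θ ≤ a}

theorem isCompact_simplex (n : ℕ) : IsCompact (simplex n) := by
  refine (isCompact_Icc (a := (0 : Fin n → ℝ)) (b := 1)).of_isClosed_subset ?_ ?_
  · have h₁ : IsClosed {x : Fin n → ℝ | ∀ i, 0 ≤ x i} := by
      simp only [Set.ofPred_forall]
      exact isClosed_iInter fun i => isClosed_le continuous_const (continuous_apply i)
    exact h₁.inter (isClosed_eq (by fun_prop) continuous_const)
  · rintro x ⟨hx, hs⟩
    refine ⟨hx, fun i => ?_⟩
    rw [Pi.one_apply, ← hs]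
    exact Finset.single_le_sum (fun j _ => hx j) (Finset.mem_univ i)

theorem continuousOn_VI {n : ℕ} (I : Finset (Fin n)) (hI : I.Nonempty) :
    ContinuousOn (VI I hI) {θ | ∑ j ∈ I, θ j ≠ 0} := by
  have h : ∀ i ∈ I, ContinuousOn (fun θ : Fin n → ℝ => θ i / ∑ j ∈ I, θ j)
      {θ | ∑ j ∈ I, θ j ≠ 0} := fun i _ =>
    (continuous_apply i).continuousOn.div (by fun_prop) fun _ hθ => hθ
  exact (ContinuousOn.finset_sup'_apply hI h).sub (ContinuousOn.finset_inf'_apply hI h)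

theorem inf'_lt_sup'_of_VI_pos {n : ℕ} {I : Finset (Fin n)} {hI : I.Nonempty} {θ : Fin n → ℝ}
    (h : 0 < VI I hI θ) : I.inf' hI θ < I.sup' hI θ := by
  by_contra! hle
  have hconst : ∀ i ∈ I, θ i = I.inf' hI θ := fun i hi =>
    le_antisymm ((I.le_sup' θ hi).trans hle) (I.inf'_le θ hi)
  refine h.ne' (sub_eq_zero.2 ?_)
  rw [Finset.sup'_congr hI rfl fun i hi => congrArg (· / ∑ j ∈ I, θ j) (hconst i hi),
    Finset.inf'_congr hI rfl fun i hi => congrArg (· / ∑ j ∈ I, θ j) (hconst i hi),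
    Finset.sup'_const, Finset.inf'_const]

/-- If `τ : Δⁿ → Δⁿ` is continuous, order preserving and contractive, `I` is a nonempty index
set, `a > 0`, and `B(a) = Δⁿ \ (Ω̲_I(a) ∪ Ω̄_I(a))` is nonempty, then the supremum of
`V_I(τ(θ)) − V_I(θ)` over the closure of `B(a)` is strictly negative. -/
theorem sup_VI_decrease_neg {n : ℕ}
    (τ : (Fin n → ℝ) → (Fin n → ℝ))
    (hτmap : ∀ θ ∈ simplex n, τ θ ∈ simplex n)
    (hτcont : ContinuousOn τ (simplex n))
    (hτord : ∀ θ ∈ simplex n, ∀ i j : Fin n,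
      (θ i < θ j → τ θ i < τ θ j) ∧ (θ i = θ j → τ θ i = τ θ j))
    (hτcontr : ∀ θ ∈ simplex n, ∀ (J : Finset (Fin n)) (hJ : J.Nonempty),
      0 < J.inf' hJ θ → J.inf' hJ θ < J.sup' hJ θ → VI J hJ (τ θ) < VI J hJ θ)
    (I : Finset (Fin n)) (hI : I.Nonempty) (a : ℝ) (ha : 0 < a)
    (hne : (simplex n \ (OmegaLow I hI a ∪ OmegaHigh I hI a)).Nonempty) :
    sSup ((fun θ => VI I hI (τ θ) - VI I hI θ) ''
        closure (simplex n \ (OmegaLow I hI a ∪ OmegaHigh I hI a))) < 0 := by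
  have hsum {θ : Fin n → ℝ} (hθ : a ≤ I.inf' hI θ) : ∑ j ∈ I, θ j ≠ 0 :=
    (Finset.sum_pos (fun i hi => ha.trans_le (hθ.trans (I.inf'_le θ hi))) hI).ne'
  have hinf : Continuous fun θ : Fin n → ℝ => I.inf' hI θ :=
    Continuous.finset_inf'_apply hI fun i _ => continuous_apply i
  have hclosed : IsClosed (simplex n ∩ {θ | a ≤ I.inf' hI θ}) :=
    (isCompact_simplex n).isClosed.inter (isClosed_le continuous_const hinf)
  have hD : IsClosed ((simplex n ∩ {θ | a ≤ I.inf' hI θ}) ∩ VI I hI ⁻¹' Set.Ici a) :=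
    ((continuousOn_VI I hI).mono fun _ hθ => hsum hθ.2).preimage_isClosed_of_isClosed
      hclosed isClosed_Ici
  have hsub : closure (simplex n \ (OmegaLow I hI a ∪ OmegaHigh I hI a)) ⊆
      (simplex n ∩ {θ | a ≤ I.inf' hI θ}) ∩ VI I hI ⁻¹' Set.Ici a := by
    refine closure_minimal ?_ hD
    rintro θ ⟨hθ, hn⟩
    simp only [OmegaLow, OmegaHigh, Set.mem_union, Set.mem_ofPred_eq, not_or, not_and,
      not_le] at hn
    exact ⟨⟨hθ, (hn.2 hθ).le⟩, (hn.1 hθ).le⟩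
  have hsumτ : ∀ θ ∈ closure (simplex n \ (OmegaLow I hI a ∪ OmegaHigh I hI a)),
      ∑ j ∈ I, τ θ j ≠ 0 := by
    intro θ hθ
    obtain ⟨⟨hs, -⟩, hV⟩ := hsub hθ
    obtain ⟨i, -, hi⟩ := I.exists_mem_eq_inf' hI θ
    obtain ⟨j, hj, hj'⟩ := I.exists_mem_eq_sup' hI θ
    have hlt := inf'_lt_sup'_of_VI_pos (ha.trans_le hV)
    rw [hi, hj'] at hlt
    have hnonneg := (hτmap θ hs).1
    exact (Finset.sum_pos' (fun k _ => hnonneg k)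
      ⟨j, hj, (hnonneg i).trans_lt ((hτord θ hs i j).1 hlt)⟩).ne'
  have hcompact : IsCompact (closure (simplex n \ (OmegaLow I hI a ∪ OmegaHigh I hI a))) :=
    (isCompact_simplex n).of_isClosed_subset isClosed_closure fun _ hθ => (hsub hθ).1.1
  have hcont : ContinuousOn (fun θ => VI I hI (τ θ) - VI I hI θ)
      (closure (simplex n \ (OmegaLow I hI a ∪ OmegaHigh I hI a))) :=
    ((continuousOn_VI I hI).comp (hτcont.mono fun _ hθ => (hsub hθ).1.1) hsumτ).sub
      ((continuousOn_VI I hI).mono fun _ hθ => hsum (hsub hθ).1.2)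
  obtain ⟨θ, hθ, heq⟩ := (hcompact.image_of_continuousOn hcont).sSup_mem (hne.closure.image _)
  rw [← heq]
  obtain ⟨⟨hs, hmin⟩, hV⟩ := hsub hθ
  exact sub_neg.2 (hτcontr θ hs I hI (ha.trans_le hmin)
    (inf'_lt_sup'_of_VI_pos (ha.trans_le hV)))
end

section
/- Let τ : Δⁿ → Δⁿ be continuous, order preserving and contractive, and define the vector field F(θ) = τ(θ) − θ. Then for every nonempty index set I ⊆ {1,…,n} there exist η̄ > 0 and a class-K function κ : [0, η̄) → [0, ∞) such that: for every η ∈ [0, η̄), every t₀ ∈ ℝ, every measurable perturbation ε : [t₀, ∞) → ℝⁿ with ‖ε(t)‖ ≤ η for all t, and every locally absolutely continuous solution θ : [t₀, ∞) → Δⁿ of the differential equation θ'(t) = F(θ(t)) + ε(t), if θ(t₀) ∉ Ω̄_I(κ(η)) then dist(θ(t), Ω̲_I(κ(η))) → 0 as t → ∞. -/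
open scoped BigOperators
open Filter

/-- The probability simplex `Δⁿ ⊆ ℝⁿ` (with the Euclidean norm). -/
def simplexE (n : ℕ) : Set (EuclideanSpace ℝ (Fin n)) :=
  {x | (∀ i, 0 ≤ x i) ∧ ∑ i, x i = 1}

/-- The Lyapunov function
`V_I(θ) = max_{i∈I} θᵢ/∑_{j∈I} θⱼ − min_{i∈I} θᵢ/∑_{j∈I} θⱼ` for a nonempty index set `I`. -/
noncomputable def VIE {n : ℕ} (I : Finset (Fin n)) (hI : I.Nonempty)
    (θ : EuclideanSpace ℝ (Fin n)) : ℝ :=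
  (I.sup' hI fun i => θ i / ∑ j ∈ I, θ j) - (I.inf' hI fun i => θ i / ∑ j ∈ I, θ j)

/-- `Ω̲_I(a) = {θ ∈ Δⁿ : V_I(θ) ≤ a}`, a neighborhood of the conditional uniform vector. -/
noncomputable def OmegaLowE {n : ℕ} (I : Finset (Fin n)) (hI : I.Nonempty) (a : ℝ) :
    Set (EuclideanSpace ℝ (Fin n)) :=
  {θ ∈ simplexE n | VIE I hI θ ≤ a}

/-- `Ω̄_I(a) = {θ ∈ Δⁿ : min_{i∈I} θᵢ ≤ a}`, a neighborhood of the simplex boundary. -/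
noncomputable def OmegaHighE {n : ℕ} (I : Finset (Fin n)) (hI : I.Nonempty) (a : ℝ) :
    Set (EuclideanSpace ℝ (Fin n)) :=
  {θ ∈ simplexE n | I.inf' hI (fun i => θ i) ≤ a}

section

open Set Topology

theorem exists_eventually_le_of_strict_descent {f : ℝ → ℝ} {t₀ a b γ : ℝ}
    (hf : ContinuousOn f (Ici t₀)) (hγ : 0 < γ) (hab : a ≤ b) (hb : f t₀ ≤ b)
    (hdesc : ∀ t, t₀ ≤ t → a ≤ f t → f t ≤ b → ∀ᶠ z in 𝓝[>] t, f z < f t - γ * (z - t)) :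
    ∀ᶠ t in atTop, f t ≤ a := by
  have barrier : ∀ (s T : ℝ) (B : ℝ → ℝ), t₀ ≤ s → Continuous B → f s ≤ B s →
      (∀ t ∈ Ico s T, a ≤ B t ∧ B t ≤ b) →
      (∀ t z, t ≤ z → B t - γ * (z - t) ≤ B z) → ∀ t ∈ Icc s T, f t ≤ B t := by
    intro s T B hs hB hfs hBab hslope
    have hfc : ContinuousOn f (Icc s T) := hf.mono fun t ht => hs.trans ht.1
    have hcl : IsClosed ({t | f t ≤ B t} ∩ Icc s T) := by
      have := isClosed_Icc.isClosed_le hfc hB.continuousOn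
      rwa [show {t | f t ≤ B t} ∩ Icc s T = {t | t ∈ Icc s T ∧ f t ≤ B t} by
        ext; simp [and_comm]]
    refine hcl.Icc_subset_of_forall_mem_nhdsWithin hfs ?_
    rintro t ⟨htle, ht⟩
    have ht₀ : t₀ ≤ t := hs.trans ht.1
    rcases lt_or_eq_of_le (show f t ≤ B t from htle) with hlt | heq
    · have h1 : ContinuousWithinAt f (Ioi t) t :=
        (hf t ht₀).mono fun z hz => ht₀.trans (le_of_lt hz)
      have h2 : ContinuousWithinAt B (Ioi t) t := hB.continuousWithinAt
      filter_upwards [h1.eventually_lt h2 hlt] with z hz using hz.le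
    · obtain ⟨h1, h2⟩ := hBab t ht
      filter_upwards [hdesc t ht₀ (heq ▸ h1) (heq ▸ h2), self_mem_nhdsWithin] with z hz hz'
      have := hslope t z (le_of_lt hz')
      show f z ≤ B z
      linarith
  set T := t₀ + (b - a) / γ with hT
  have hT₀ : t₀ ≤ T := by
    have : 0 ≤ (b - a) / γ := div_nonneg (by linarith) hγ.le
    linarith
  have hTγ : γ * (T - t₀) = b - a := by rw [hT]; field_simp; ring
  have hfT : f T ≤ a := by
    have := barrier t₀ T (fun t => b - γ * (t - t₀)) le_rfl (by fun_prop) (by simpa using hb)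
      (fun t ht => ⟨by nlinarith [ht.2], by nlinarith [ht.1]⟩)
      (fun t z _ => by linarith) T ⟨hT₀, le_rfl⟩
    linarith
  filter_upwards [eventually_ge_atTop T] with t ht
  exact barrier T t (fun _ => a) hT₀ continuous_const hfT (fun _ _ => ⟨le_rfl, hab⟩)
    (fun s z hsz => by nlinarith) t ⟨ht, le_rfl⟩

/-- The consequences of `θ' = τ(θ) - θ + ε`, `‖ε‖ ≤ η`, used in the convergence proof: `θ` is
continuous, stays in the simplex, and any linear functional that decreases at rate more than `γ`
under the worst-case perturbation decreases at rate `γ` to the right of the given time. -/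
structure IsPerturbedTrajectory {n : ℕ}
    (τ : EuclideanSpace ℝ (Fin n) → EuclideanSpace ℝ (Fin n)) (η t₀ : ℝ)
    (θ : ℝ → EuclideanSpace ℝ (Fin n)) : Prop where
  cont : ContinuousOn θ (Ici t₀)
  mem : ∀ t, t₀ ≤ t → θ t ∈ simplexE n
  descent : ∀ (L : EuclideanSpace ℝ (Fin n) →L[ℝ] ℝ) (C γ : ℝ), ‖L‖ ≤ C → ∀ t, t₀ ≤ t →
    L (τ (θ t) - θ t) + C * η < -γ → ∀ᶠ z in 𝓝[>] t, L (θ z) - L (θ t) < -γ * (z - t)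

namespace IsPerturbedTrajectory

variable {n : ℕ} {τ : EuclideanSpace ℝ (Fin n) → EuclideanSpace ℝ (Fin n)} {η t₀ : ℝ}
  {θ : ℝ → EuclideanSpace ℝ (Fin n)}

theorem mono {t₁ : ℝ} (h : IsPerturbedTrajectory τ η t₀ θ) (ht : t₀ ≤ t₁) :
    IsPerturbedTrajectory τ η t₁ θ where
  cont := h.cont.mono (Ici_subset_Ici.2 ht)
  mem t ht' := h.mem t (ht.trans ht')
  descent L C γ hL t ht' := h.descent L C γ hL t (ht.trans ht')

theorem of_integral_eq (hτcont : ContinuousOn τ (simplexE n))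
    {ε : ℝ → EuclideanSpace ℝ (Fin n)} (hε : Measurable ε) (hεη : ∀ t, t₀ ≤ t → ‖ε t‖ ≤ η)
    (hθ : ContinuousOn θ (Ici t₀)) (hmem : ∀ t, t₀ ≤ t → θ t ∈ simplexE n)
    (hint : ∀ t, t₀ ≤ t → θ t = θ t₀ + ∫ s in t₀..t, (τ (θ s) - θ s + ε s)) :
    IsPerturbedTrajectory τ η t₀ θ where
  cont := hθ
  mem := hmem
  descent := by
    intro L C γ hL t ht hlt
    have hF : ContinuousOn (fun s => τ (θ s) - θ s) (Ici t₀) :=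
      (hτcont.comp hθ fun s hs => hmem s hs).sub hθ
    have hG : ∀ a b, t₀ ≤ a → a ≤ b →
        IntervalIntegrable (fun s => τ (θ s) - θ s + ε s) MeasureTheory.volume a b := by
      intro a b ha hab
      refine IntervalIntegrable.add ?_ ?_
      · refine ContinuousOn.intervalIntegrable (hF.mono ?_)
        rw [uIcc_of_le hab]
        exact fun s hs => ha.trans hs.1
      · refine (intervalIntegrable_const (c := η)).mono_fun' hε.aestronglyMeasurable ?_
        rw [Set.uIoc_of_le hab]
        filter_upwards [MeasureTheory.ae_restrict_mem measurableSet_Ioc] with s hs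
        exact hεη s (ha.trans hs.1.le)
    obtain ⟨γ', h1, h2⟩ := exists_between hlt
    have hcont : ContinuousWithinAt (fun s => L (τ (θ s) - θ s) + C * η) (Ici t) t := by
      have := (L.continuous.comp_continuousOn hF).add
        (continuousOn_const (c := C * η) (s := Ici t₀))
      exact (this t ht).mono (Ici_subset_Ici.2 ht)
    have hev : ∀ᶠ s in 𝓝[≥] t, L (τ (θ s) - θ s) + C * η < γ' := hcont.eventually_lt_const h1
    obtain ⟨u, hu, hsub⟩ := mem_nhdsGE_iff_exists_Ico_subset.1 hev
    filter_upwards [Ioo_mem_nhdsGT hu] with z hz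
    have hdiff : θ z - θ t = ∫ s in t..z, (τ (θ s) - θ s + ε s) := by
      rw [hint z (ht.trans hz.1.le), hint t ht, add_sub_add_left_eq_sub,
        intervalIntegral.integral_interval_sub_left (hG _ _ le_rfl (ht.trans hz.1.le))
          (hG _ _ le_rfl ht)]
    have hi := hG t z ht hz.1.le
    rw [← map_sub, hdiff, ← L.intervalIntegral_comp_comm hi]
    have hle : ∫ s in t..z, L (τ (θ s) - θ s + ε s) ≤ ∫ _ in t..z, γ' := by
      refine intervalIntegral.integral_mono_on hz.1.le
        ⟨L.integrable_comp hi.1, L.integrable_comp hi.2⟩ intervalIntegrable_const ?_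
      intro s hs
      have h3 : L (τ (θ s) - θ s) + C * η < γ' := hsub ⟨hs.1, hs.2.trans_lt hz.2⟩
      have h4 : L (ε s) ≤ C * η := calc
        L (ε s) ≤ ‖L (ε s)‖ := le_abs_self _
        _ ≤ C * η := L.le_of_opNorm_le_of_le hL (hεη s (ht.trans hs.1))
      rw [map_add]
      linarith
    rw [intervalIntegral.integral_const, smul_eq_mul] at hle
    have : (z - t) * γ' < (z - t) * -γ := mul_lt_mul_of_pos_left h2 (sub_pos.2 hz.1)
    linarith

end IsPerturbedTrajectory

theorem exists_classK_of_forall_pos (P : ℝ → ℝ → Prop)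
    (hmono : ∀ η x y, x ≤ y → P η x → P η y)
    (hP : ∀ x > 0, ∃ δ > 0, ∀ η, 0 ≤ η → η < δ → P η x) :
    ∃ ηbar > (0 : ℝ), ∃ κ : ℝ → ℝ,
      (ContinuousOn κ (Set.Ico 0 ηbar) ∧ StrictMonoOn κ (Set.Ico 0 ηbar) ∧ κ 0 = 0 ∧
        ∀ x ∈ Set.Ico (0 : ℝ) ηbar, 0 ≤ κ x) ∧
      ∀ η, 0 < η → η < ηbar → P η (κ η) := by
  have hP' : ∀ x : Ioi (0 : ℝ), ∃ δ : ℝ, 0 < δ ∧ δ ≤ 1 ∧ ∀ η, 0 ≤ η → η < δ → P η x := by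
    intro x
    obtain ⟨δ, hδ, h⟩ := hP x x.2
    exact ⟨min δ 1, lt_min hδ one_pos, min_le_right _ _,
      fun η h0 h1 => h η h0 (h1.trans_le (min_le_left _ _))⟩
  choose δ hδ0 hδ1 hδP using hP'
  let κ : ℝ → ℝ := fun η => ⨅ x : Ioi (0 : ℝ), (x + η / δ x)
  have hnn : ∀ η, 0 ≤ η → ∀ x : Ioi (0 : ℝ), 0 ≤ (x : ℝ) + η / δ x := fun η hη x =>
    add_nonneg (le_of_lt x.2) (div_nonneg hη (hδ0 x).le)
  have hle : ∀ η, 0 ≤ η → ∀ x : Ioi (0 : ℝ), κ η ≤ x + η / δ x := fun η hη x =>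
    ciInf_le ⟨0, by rintro _ ⟨y, rfl⟩; exact hnn η hη y⟩ x
  have : Nonempty (Ioi (0 : ℝ)) := ⟨⟨1, mem_Ioi.2 one_pos⟩⟩
  have hκ0 : ∀ η, 0 ≤ η → 0 ≤ κ η := fun η hη => le_ciInf (hnn η hη)
  have hgrow : ∀ η₁ η₂, 0 ≤ η₁ → η₁ ≤ η₂ → κ η₁ + (η₂ - η₁) ≤ κ η₂ := by
    intro η₁ η₂ h0 h
    refine le_ciInf fun x => ?_
    have h1 := hle η₁ h0 x
    have h2 : η₂ - η₁ ≤ (η₂ - η₁) / δ x := le_div_self (by linarith) (hδ0 x) (hδ1 x)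
    rw [sub_div] at h2
    linarith
  have hconc : ConcaveOn ℝ (Ici 0) κ := by
    refine ⟨convex_Ici 0, fun η₁ h₁ η₂ h₂ a b ha hb hab => le_ciInf fun x => ?_⟩
    have e1 := mul_le_mul_of_nonneg_left (hle η₁ h₁ x) ha
    have e2 := mul_le_mul_of_nonneg_left (hle η₂ h₂ x) hb
    simp only [smul_eq_mul]
    have : (x : ℝ) + (a * η₁ + b * η₂) / δ x
        = a * (x + η₁ / δ x) + b * (x + η₂ / δ x) := by
      linear_combination -(x : ℝ) * hab
    linarith
  have hzero : κ 0 = 0 := by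
    refine le_antisymm (le_of_forall_pos_le_add fun e he => ?_) (hκ0 0 le_rfl)
    simpa using hle 0 le_rfl ⟨e, he⟩
  have hcont0 : ContinuousWithinAt κ (Ici 0) 0 := by
    rw [Metric.continuousWithinAt_iff]
    intro e he
    refine ⟨δ ⟨e / 2, half_pos he⟩ * (e / 2), mul_pos (hδ0 _) (half_pos he), ?_⟩
    intro η hη hd
    have hη' : 0 ≤ η := hη
    rw [Real.dist_eq, sub_zero, abs_of_nonneg hη'] at hd
    rw [Real.dist_eq, hzero, sub_zero, abs_of_nonneg (hκ0 η hη')]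
    have h1 := hle η hη' ⟨e / 2, half_pos he⟩
    have h2 : η / δ ⟨e / 2, half_pos he⟩ < e / 2 := by
      rw [div_lt_iff₀ (hδ0 _)]; linarith
    simp only at h1
    linarith
  have hcont : ContinuousOn κ (Ici 0) := by
    intro η hη
    rcases eq_or_lt_of_le (show (0 : ℝ) ≤ η from hη) with rfl | hpos
    · exact hcont0
    · have := hconc.continuousOn_interior
      rw [interior_Ici] at this
      exact (this.continuousAt (Ioi_mem_nhds hpos)).continuousWithinAt
  let q : Ioi (0 : ℝ) := ⟨1 / 8, by norm_num⟩
  refine ⟨δ q / 8, by have := hδ0 q; positivity, κ,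
    ⟨hcont.mono fun x hx => hx.1, ?_, hzero, fun x hx => hκ0 x hx.1⟩, ?_⟩
  · intro x hx y _ hxy
    have := hgrow x y hx.1 hxy.le
    linarith
  · intro η hη hlt
    obtain ⟨x, hx⟩ := exists_lt_of_ciInf_lt (show κ η < κ η + η / 2 by linarith)
    have h1 : η ≤ η / δ x := le_div_self hη.le (hδ0 x) (hδ1 x)
    have h2 := hle η hη.le q
    have h3 : η / δ q < 1 / 8 := by rw [div_lt_iff₀ (hδ0 q)]; linarith
    have h4 : η < 1 / 8 := by linarith [hδ1 q]
    have h5 : (0 : ℝ) < x := x.2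
    have h6 : η / δ x < 1 := by
      have : (q : ℝ) = 1 / 8 := rfl
      linarith
    rw [div_lt_one (hδ0 x)] at h6
    exact hmono η x (κ η) (by linarith) (hδP x η hη.le h6)

theorem VIE_pair {n : ℕ} {i j : Fin n} (θ : EuclideanSpace ℝ (Fin n)) (hij : i ≠ j)
    (hsum : 0 ≤ θ i + θ j) (hle : θ i ≤ θ j) (h : ({i, j} : Finset (Fin n)).Nonempty) :
    VIE {i, j} h θ = (θ j - θ i) / (θ i + θ j) := by
  have : θ i / (θ i + θ j) ≤ θ j / (θ i + θ j) := div_le_div_of_nonneg_right hle hsum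
  simp only [VIE, Finset.sum_pair hij]
  rw [Finset.sup'_insert (Finset.singleton_nonempty j),
    Finset.inf'_insert (Finset.singleton_nonempty j)]
  simp only [Finset.sup'_singleton, Finset.inf'_singleton]
  rw [sup_eq_right.2 this, inf_eq_left.2 this, sub_div]

/-- The order-preserving and contractive properties of `τ`, reduced to pairs of coordinates. -/
structure IsPairContractive {n : ℕ}
    (τ : EuclideanSpace ℝ (Fin n) → EuclideanSpace ℝ (Fin n)) : Prop where
  map : ∀ θ ∈ simplexE n, τ θ ∈ simplexE n
  cont : ContinuousOn τ (simplexE n)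
  apply_eq_of_eq : ∀ θ ∈ simplexE n, ∀ i j, θ i = θ j → τ θ i = τ θ j
  mul_lt_mul_of_lt : ∀ θ ∈ simplexE n, ∀ i j, 0 < θ i → θ i < θ j → θ i * τ θ j < τ θ i * θ j

namespace IsPairContractive

variable {n : ℕ} {τ : EuclideanSpace ℝ (Fin n) → EuclideanSpace ℝ (Fin n)}

theorem of_contractive (hτmap : ∀ θ ∈ simplexE n, τ θ ∈ simplexE n)
    (hτcont : ContinuousOn τ (simplexE n))
    (hτord : ∀ θ ∈ simplexE n, ∀ i j : Fin n,
      (θ i < θ j → τ θ i < τ θ j) ∧ (θ i = θ j → τ θ i = τ θ j))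
    (hτcontr : ∀ θ ∈ simplexE n, ∀ (J : Finset (Fin n)) (hJ : J.Nonempty),
      0 < J.inf' hJ (fun i => θ i) → J.inf' hJ (fun i => θ i) < J.sup' hJ (fun i => θ i) →
        VIE J hJ (τ θ) < VIE J hJ θ) : IsPairContractive τ where
  map := hτmap
  cont := hτcont
  apply_eq_of_eq θ hθ i j := (hτord θ hθ i j).2
  mul_lt_mul_of_lt θ hθ i j hi hij := by
    have hne : i ≠ j := by rintro rfl; exact lt_irrefl _ hij
    have hτij := (hτord θ hθ i j).1 hij
    have h0 := (hτmap θ hθ).1 i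
    have key := hτcontr θ hθ {i, j} (Finset.insert_nonempty i {j})
      (by simp only [Finset.lt_inf'_iff, Finset.mem_insert, Finset.mem_singleton]
          rintro k (rfl | rfl)
          exacts [hi, hi.trans hij])
      (((Finset.inf'_le _ (by simp)).trans_lt hij).trans_le
        (Finset.le_sup' (fun k => θ k) (by simp)))
    rw [VIE_pair _ hne (by linarith) hτij.le, VIE_pair _ hne (by linarith) hij.le,
      div_lt_div_iff₀ (by linarith) (by linarith)] at key
    nlinarith

theorem mul_le_mul_of_le (h : IsPairContractive τ) {θ : EuclideanSpace ℝ (Fin n)} (hθ : θ ∈ simplexE n)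
    {i j : Fin n} (hij : θ i ≤ θ j) : θ i * τ θ j ≤ τ θ i * θ j := by
  rcases hij.lt_or_eq with hlt | heq
  · rcases (hθ.1 i).lt_or_eq with hi | hi
    · exact (h.mul_lt_mul_of_lt θ hθ i j hi hlt).le
    · rw [← hi, zero_mul]
      exact mul_nonneg ((h.map θ hθ).1 i) (hθ.1 j)
  · rw [heq, h.apply_eq_of_eq θ hθ i j heq, mul_comm]

/-- `τ` moves mass into any set of coordinates lying below all the others, if it carries some mass
already and does not consist of maximal coordinates only. -/
theorem sum_lt_sum (h : IsPairContractive τ) {θ : EuclideanSpace ℝ (Fin n)} (hθ : θ ∈ simplexE n)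
    {J : Finset (Fin n)} (hJ : ∀ p ∈ J, ∀ q ∉ J, θ p ≤ θ q) (hpos : 0 < ∑ p ∈ J, θ p)
    {q : Fin n} (hq : q ∉ J) (hlt : ∀ p ∈ J, θ p < θ q) :
    ∑ p ∈ J, θ p < ∑ p ∈ J, τ θ p := by
  obtain ⟨p, hp, hp0⟩ : ∃ p ∈ J, 0 < θ p := by
    by_contra! hcon
    exact absurd (Finset.sum_nonpos hcon) (not_le.2 hpos)
  have e1 := Finset.sum_add_sum_compl J (fun p => θ p)
  have e2 := Finset.sum_add_sum_compl J (fun p => τ θ p)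
  rw [hθ.2] at e1
  rw [(h.map θ hθ).2] at e2
  have key : ∑ p ∈ J, ∑ q ∈ Jᶜ, θ p * τ θ q < ∑ p ∈ J, ∑ q ∈ Jᶜ, τ θ p * θ q := by
    refine Finset.sum_lt_sum (fun p hp => Finset.sum_le_sum fun q hq =>
      h.mul_le_mul_of_le hθ (hJ p hp q (Finset.mem_compl.1 hq))) ⟨p, hp, ?_⟩
    exact Finset.sum_lt_sum (fun q hq => h.mul_le_mul_of_le hθ (hJ p hp q (Finset.mem_compl.1 hq)))
      ⟨q, Finset.mem_compl.2 hq, h.mul_lt_mul_of_lt θ hθ p q hp0 (hlt p hp)⟩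
  rw [← Finset.sum_mul_sum, ← Finset.sum_mul_sum] at key
  nlinarith

end IsPairContractive

theorem isCompact_simplexE (n : ℕ) : IsCompact (simplexE n) := by
  have : simplexE n = (EuclideanSpace.equiv (Fin n) ℝ) ⁻¹' stdSimplex ℝ (Fin n) := by
    ext x
    simp [simplexE, stdSimplex]
  rw [this]
  exact (EuclideanSpace.equiv (Fin n) ℝ).toHomeomorph.isCompact_preimage.2
    (isCompact_stdSimplex ℝ (Fin n))

theorem simplexE.le_one {n : ℕ} {θ : EuclideanSpace ℝ (Fin n)} (hθ : θ ∈ simplexE n) (i : Fin n) :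
    θ i ≤ 1 := by
  rw [← hθ.2]
  exact Finset.single_le_sum (fun j _ => hθ.1 j) (Finset.mem_univ i)

/-- The smallest mass, discounted by `2⁻¹` per element, of a set of coordinates containing `i`. -/
noncomputable def discountedMass {n : ℕ} (i : Fin n) (θ : EuclideanSpace ℝ (Fin n)) : ℝ :=
  (Finset.univ.filter fun J : Finset (Fin n) => i ∈ J).inf'
    (Finset.filter_nonempty_iff.2 ⟨{i}, by simp⟩)
    fun J => (1 / 2) ^ J.card * ∑ k ∈ J, θ k

theorem continuous_discountedMass {n : ℕ} (i : Fin n) :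
    Continuous (discountedMass i : EuclideanSpace ℝ (Fin n) → ℝ) :=
  Continuous.finset_inf'_apply _ fun J _ => by fun_prop

theorem discountedMass_le {n : ℕ} {i : Fin n} {J : Finset (Fin n)} (hJ : i ∈ J)
    (θ : EuclideanSpace ℝ (Fin n)) :
    discountedMass i θ ≤ (1 / 2) ^ J.card * ∑ k ∈ J, θ k :=
  Finset.inf'_le (fun J : Finset (Fin n) => (1 / 2 : ℝ) ^ J.card * ∑ k ∈ J, θ k) (by simpa using hJ)

theorem lt_discountedMass_iff {n : ℕ} {i : Fin n} {θ : EuclideanSpace ℝ (Fin n)} {c : ℝ} :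
    c < discountedMass i θ ↔ ∀ J : Finset (Fin n), i ∈ J → c < (1 / 2) ^ J.card * ∑ k ∈ J, θ k := by
  simp [discountedMass, Finset.lt_inf'_iff]

theorem le_discountedMass {n : ℕ} {i : Fin n} {θ : EuclideanSpace ℝ (Fin n)}
    (hθ : θ ∈ simplexE n) : (1 / 2) ^ n * θ i ≤ discountedMass i θ := by
  refine Finset.le_inf' _ _ fun J hJ => ?_
  have hcard : J.card ≤ n := by simpa using J.card_le_univ
  exact mul_le_mul (pow_le_pow_of_le_one (by norm_num) (by norm_num) hcard)
    (Finset.single_le_sum (fun j _ => hθ.1 j) (by simpa using hJ)) (hθ.1 i) (by positivity)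

theorem IsPairContractive.sum_lt_sum_of_eq_discountedMass {n : ℕ}
    {τ : EuclideanSpace ℝ (Fin n) → EuclideanSpace ℝ (Fin n)} (h : IsPairContractive τ)
    {θ : EuclideanSpace ℝ (Fin n)} (hθ : θ ∈ simplexE n) {i : Fin n} {J : Finset (Fin n)}
    (hi : i ∈ J) (heq : (1 / 2) ^ J.card * ∑ k ∈ J, θ k = discountedMass i θ)
    (hpos : 0 < discountedMass i θ) (hsmall : n * discountedMass i θ < (1 / 2) ^ n) :
    ∑ p ∈ J, θ p < ∑ p ∈ J, τ θ p := by
  have hcard : J.card ≤ n := by simpa using J.card_le_univ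
  have hw : (0 : ℝ) < (1 / 2) ^ J.card := by positivity
  have hS : 0 < ∑ k ∈ J, θ k := by
    rw [← heq] at hpos
    exact (mul_pos_iff_of_pos_left hw).1 hpos
  have hle : ∀ p ∈ J, θ p ≤ ∑ k ∈ J, θ k := fun p hp =>
    Finset.single_le_sum (fun j _ => hθ.1 j) hp
  have hge : ∀ q ∉ J, ∑ k ∈ J, θ k ≤ θ q := by
    intro q hq
    have := discountedMass_le (Finset.mem_insert_of_mem (b := q) hi) θ
    rw [← heq, Finset.card_insert_of_notMem hq, Finset.sum_insert hq, pow_succ, mul_assoc] at this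
    have := le_of_mul_le_mul_left this hw
    linarith
  obtain ⟨q, hq⟩ : ∃ q, ∑ k ∈ J, θ k < θ q := by
    by_contra! hcon
    have h1 : (1 : ℝ) ≤ n * ∑ k ∈ J, θ k := by
      rw [← hθ.2]
      simpa using Finset.sum_le_sum fun q (_ : q ∈ Finset.univ) => hcon q
    have h2 : (1 / 2 : ℝ) ^ n ≤ (1 / 2) ^ J.card :=
      pow_le_pow_of_le_one (by norm_num) (by norm_num) hcard
    rw [← heq] at hsmall
    nlinarith
  exact h.sum_lt_sum hθ (fun p hp q hq => (hle p hp).trans (hge q hq)) hS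
    (fun hqJ => absurd (hle q hqJ) (not_le.2 hq)) fun p hp => (hle p hp).trans_lt hq

/-- The linear functional summing the coordinates in `J`, discounted by `2⁻¹` per element. -/
noncomputable def massFunctional {n : ℕ} (J : Finset (Fin n)) :
    EuclideanSpace ℝ (Fin n) →L[ℝ] ℝ :=
  (1 / 2 : ℝ) ^ J.card • ∑ k ∈ J, EuclideanSpace.proj k

theorem massFunctional_apply {n : ℕ} (J : Finset (Fin n)) (v : EuclideanSpace ℝ (Fin n)) :
    massFunctional J v = (1 / 2) ^ J.card * ∑ k ∈ J, v k := by
  simp [massFunctional]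

theorem eventually_nhdsGE_mul_lt (c : ℝ) {γ : ℝ} (hγ : 0 < γ) :
    ∀ᶠ η in 𝓝[≥] (0 : ℝ), c * η < γ := by
  have : Tendsto (fun η : ℝ => c * η) (𝓝[≥] 0) (𝓝 0) := by
    simpa using ((continuous_const_mul c).tendsto 0).mono_left nhdsWithin_le_nhds
  exact this.eventually_lt_const hγ

namespace IsPairContractive

variable {n : ℕ} {τ : EuclideanSpace ℝ (Fin n) → EuclideanSpace ℝ (Fin n)}

theorem exists_forall_lt_massFunctional_sub (h : IsPairContractive τ) (i : Fin n) {a ρ : ℝ}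
    (ha : 0 < a) (hρ : n * ρ < (1 / 2) ^ n) :
    ∃ γ > 0, ∀ J : Finset (Fin n), i ∈ J → ∀ θ ∈ simplexE n,
      a ≤ discountedMass i θ → discountedMass i θ ≤ ρ →
      massFunctional J θ = discountedMass i θ → γ < massFunctional J (τ θ - θ) := by
  have hJ : ∀ J : Finset (Fin n), i ∈ J → ∃ γ > 0, ∀ θ ∈ simplexE n,
      a ≤ discountedMass i θ → discountedMass i θ ≤ ρ →
      massFunctional J θ = discountedMass i θ → γ ≤ massFunctional J (τ θ - θ) := by
    intro J hi
    have hc := continuous_discountedMass i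
    let K := simplexE n ∩ {θ | (a ≤ discountedMass i θ ∧ discountedMass i θ ≤ ρ) ∧
      massFunctional J θ = discountedMass i θ}
    have hK : IsCompact K := (isCompact_simplexE n).inter_right <|
      ((isClosed_le continuous_const hc).inter (isClosed_le hc continuous_const)).inter
        (isClosed_eq (massFunctional J).continuous hc)
    have hcont : ContinuousOn (fun θ => massFunctional J (τ θ - θ)) K :=
      (massFunctional J).continuous.comp_continuousOn
        ((h.cont.mono inter_subset_left).sub continuousOn_id)
    obtain ⟨γ, hγ, hle⟩ := hK.exists_forall_le' hcont (a := 0) fun θ hθ => by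
      obtain ⟨hθ, ⟨h1, h2⟩, h3⟩ := hθ
      have := h.sum_lt_sum_of_eq_discountedMass hθ hi (by rw [← h3, massFunctional_apply])
        (ha.trans_le h1)
        ((mul_le_mul_of_nonneg_left h2 (Nat.cast_nonneg n)).trans_lt hρ)
      rw [map_sub, massFunctional_apply, massFunctional_apply, ← mul_sub]
      exact mul_pos (by positivity) (sub_pos.2 this)
    exact ⟨γ, hγ, fun θ hθ h1 h2 h3 => hle θ ⟨hθ, ⟨h1, h2⟩, h3⟩⟩
  choose! γ hγ hle using hJ
  have hev : ∀ᶠ g in 𝓝[>] (0 : ℝ), ∀ J : Finset (Fin n), i ∈ J → g < γ J := by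
    refine eventually_all.2 fun J => ?_
    by_cases hi : i ∈ J
    · filter_upwards [Ioo_mem_nhdsGT (hγ J hi)] with g hg _ using hg.2
    · exact Eventually.of_forall fun g hi' => absurd hi' hi
  obtain ⟨g, hg, hg0⟩ := (hev.and self_mem_nhdsWithin).exists
  exact ⟨g, hg0, fun J hi θ hθ h1 h2 h3 => (hg J hi).trans_le (hle J hi θ hθ h1 h2 h3)⟩

theorem eventually_forall_le_coord (h : IsPairContractive τ) (i : Fin n) {x ρ : ℝ}
    (hx : 0 < x) (hρ0 : 0 < ρ) (hρ : n * ρ < (1 / 2) ^ n) :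
    ∀ᶠ η in 𝓝[≥] (0 : ℝ), ∀ t₀ θ, IsPerturbedTrajectory τ η t₀ θ → x ≤ θ t₀ i →
      ∀ᶠ t in atTop, ρ ≤ θ t i := by
  have ha : 0 < min ((1 / 2) ^ n * x) ρ := lt_min (by positivity) hρ0
  set a := min ((1 / 2) ^ n * x) ρ
  obtain ⟨γ, hγ, hrate⟩ := h.exists_forall_lt_massFunctional_sub i ha hρ
  have hev : ∀ᶠ η in 𝓝[≥] (0 : ℝ), ∀ J : Finset (Fin n), ‖-massFunctional J‖ * η < γ / 2 :=
    eventually_all.2 fun J => eventually_nhdsGE_mul_lt _ (half_pos hγ)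
  filter_upwards [hev] with η hη t₀ θ hθ hx₀
  have hcont : ContinuousOn (fun t => -discountedMass i (θ t)) (Ici t₀) :=
    ((continuous_discountedMass i).comp_continuousOn hθ.cont).neg
  have hmain := exists_eventually_le_of_strict_descent (a := -ρ) (b := -a) hcont (half_pos hγ)
    (neg_le_neg (min_le_right _ _))
    (neg_le_neg ((min_le_left _ _).trans ((mul_le_mul_of_nonneg_left hx₀ (by positivity)).trans
      (le_discountedMass (hθ.mem t₀ le_rfl))))) ?_
  · filter_upwards [hmain, eventually_ge_atTop t₀] with t ht ht₀
    have h1 := discountedMass_le (Finset.mem_singleton_self i) (θ t)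
    have h2 := (hθ.mem t ht₀).1 i
    simp only [Finset.card_singleton, pow_one, Finset.sum_singleton] at h1
    linarith
  · intro t ht h1 h2
    have hJ : ∀ J : Finset (Fin n), ∀ᶠ z in 𝓝[>] t, i ∈ J →
        discountedMass i (θ t) + γ / 2 * (z - t) < massFunctional J (θ z) := by
      intro J
      by_cases hi : i ∈ J
      swap
      · exact Eventually.of_forall fun z hi' => absurd hi' hi
      have hle := discountedMass_le hi (θ t)
      rw [← massFunctional_apply] at hle
      rcases hle.eq_or_lt with heq | hlt
      · have hr := hrate J hi (θ t) (hθ.mem t ht) (neg_le_neg_iff.1 h2) (neg_le_neg_iff.1 h1)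
          heq.symm
        have hd := hθ.descent (-massFunctional J) _ (γ / 2) le_rfl t ht (by
          have := hη J
          rw [neg_apply]
          linarith)
        filter_upwards [hd] with z hz _
        simp only [neg_apply] at hz
        linarith
      · have hc1 : ContinuousWithinAt (fun z => discountedMass i (θ t) + γ / 2 * (z - t))
            (Ioi t) t := by fun_prop
        have hc2 : ContinuousWithinAt (fun z => massFunctional J (θ z)) (Ioi t) t :=
          ((massFunctional J).continuous.comp_continuousOn hθ.cont t ht).mono
            fun z hz => ht.trans (le_of_lt hz)
        filter_upwards [hc1.eventually_lt hc2 (by simpa using hlt)] with z hz _ using hz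
    filter_upwards [eventually_all.2 hJ] with z hz
    have : discountedMass i (θ t) + γ / 2 * (z - t) < discountedMass i (θ z) :=
      lt_discountedMass_iff.2 fun J hi => by
        rw [← massFunctional_apply]
        exact hz J hi
    linarith

theorem eventually_forall_coord_le_mul (h : IsPairContractive τ) (i j : Fin n) {v ρ : ℝ}
    (hv : 0 < v) (hρ0 : 0 < ρ) :
    ∀ᶠ η in 𝓝[≥] (0 : ℝ), ∀ t₀ θ, IsPerturbedTrajectory τ η t₀ θ →
      (∀ t, t₀ ≤ t → ρ ≤ θ t j) → ∀ᶠ t in atTop, θ t i ≤ (1 + v) * θ t j := by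
  let π : Fin n → EuclideanSpace ℝ (Fin n) →L[ℝ] ℝ := fun k => EuclideanSpace.proj k
  have hπ : ∀ k x, π k x = x k := fun _ _ => rfl
  have hc : ∀ k : Fin n, Continuous fun θ : EuclideanSpace ℝ (Fin n) => θ k :=
    fun k => (π k).continuous
  let K := simplexE n ∩ {θ | ρ ≤ θ j ∧ (1 + v) * θ j ≤ θ i}
  have hK : IsCompact K := (isCompact_simplexE n).inter_right <|
    (isClosed_le continuous_const (hc j)).inter (isClosed_le ((hc j).const_mul _) (hc i))
  have hτc : ∀ k : Fin n, ContinuousOn (fun θ => τ θ k) K := fun k =>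
    (hc k).comp_continuousOn (h.cont.mono inter_subset_left)
  have hj : ∀ θ ∈ K, 0 < θ j := fun θ hθ => hρ0.trans_le hθ.2.1
  have hcont : ContinuousOn (fun θ => θ i / θ j * τ θ j - τ θ i) K :=
    (((hc i).continuousOn.div (hc j).continuousOn fun θ hθ => (hj θ hθ).ne').mul (hτc j)).sub (hτc i)
  obtain ⟨γ, hγ, hrate⟩ := hK.exists_forall_le' hcont (a := 0) fun θ hθ => by
    have h1 := h.mul_lt_mul_of_lt θ hθ.1 j i (hj θ hθ) (by nlinarith [hj θ hθ, hθ.2.2])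
    rw [sub_pos, div_mul_eq_mul_div, lt_div_iff₀ (hj θ hθ)]
    linarith
  filter_upwards [eventually_nhdsGE_mul_lt (‖π i‖ + 1 / ρ * ‖π j‖) (half_pos hγ),
    self_mem_nhdsWithin] with η hη hη0 t₀ θ hθ hρθ
  have hpos : ∀ t, t₀ ≤ t → 0 < θ t j := fun t ht => hρ0.trans_le (hρθ t ht)
  have hθc : ∀ k : Fin n, ContinuousOn (fun t => θ t k) (Ici t₀) :=
    fun k => (hc k).comp_continuousOn hθ.cont
  have hmain := exists_eventually_le_of_strict_descent (f := fun t => θ t i / θ t j)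
    (a := 1 + v) (b := max (1 + v) (θ t₀ i / θ t₀ j))
    ((hθc i).div (hθc j) fun t ht => (hpos t ht).ne') (half_pos hγ)
    (le_max_left _ _) (le_max_right _ _) ?_
  · filter_upwards [hmain, eventually_ge_atTop t₀] with t ht ht₀
    rwa [div_le_iff₀ (hpos t ht₀)] at ht
  · intro t ht h1 _
    set R := θ t i / θ t j with hR
    have hRi : R * θ t j = θ t i := div_mul_cancel₀ _ (hpos t ht).ne'
    have hR0 : 0 ≤ R := by linarith
    have hRρ : R ≤ 1 / ρ :=
      div_le_div₀ zero_le_one (simplexE.le_one (hθ.mem t ht) i) hρ0 (hρθ t ht)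
    have hr := hrate (θ t) ⟨hθ.mem t ht, hρθ t ht, (le_div_iff₀ (hpos t ht)).1 h1⟩
    have hnorm : ‖π i - R • π j‖ ≤ ‖π i‖ + 1 / ρ * ‖π j‖ := by
      refine (norm_sub_le _ _).trans (add_le_add_right ?_ _)
      rw [norm_smul, Real.norm_of_nonneg hR0]
      exact mul_le_mul_of_nonneg_right hRρ (norm_nonneg _)
    have hd := hθ.descent (π i - R • π j) _ (γ / 2) hnorm t ht (by
      simp only [sub_apply, smul_apply, smul_eq_mul, hπ, PiLp.sub_apply]
      rw [← hR] at hr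
      linarith)
    filter_upwards [hd, self_mem_nhdsWithin] with z hz htz
    have htz' : t < z := htz
    have hz0 := hpos z (ht.trans htz'.le)
    have hz1 := simplexE.le_one (hθ.mem z (ht.trans htz'.le)) j
    simp only [sub_apply, smul_apply, smul_eq_mul, hπ] at hz
    rw [div_lt_iff₀ hz0]
    have : γ / 2 * (z - t) * θ z j ≤ γ / 2 * (z - t) :=
      mul_le_of_le_one_right (mul_nonneg (half_pos hγ).le (by linarith)) hz1
    linarith

end IsPairContractive

theorem VIE_le_of_forall_le_mul {n : ℕ} {I : Finset (Fin n)} (hI : I.Nonempty)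
    {θ : EuclideanSpace ℝ (Fin n)} {v : ℝ} (hv : 0 ≤ v) (hpos : ∀ i ∈ I, 0 < θ i)
    (h : ∀ i ∈ I, ∀ j ∈ I, θ i ≤ (1 + v) * θ j) : VIE I hI θ ≤ v := by
  have hS : 0 < ∑ k ∈ I, θ k := Finset.sum_pos hpos hI
  rw [VIE, sub_le_iff_le_add, Finset.sup'_le_iff]
  intro i hi
  rw [← sub_le_iff_le_add', Finset.le_inf'_iff]
  intro j hj
  have hle : θ j ≤ ∑ k ∈ I, θ k := Finset.single_le_sum (fun k hk => (hpos k hk).le) hj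
  have := h i hi j hj
  rw [sub_le_iff_le_add, ← sub_le_iff_le_add', ← sub_div, div_le_iff₀ hS]
  nlinarith

theorem IsPairContractive.exists_forall_eventually_VIE_le {n : ℕ}
    {τ : EuclideanSpace ℝ (Fin n) → EuclideanSpace ℝ (Fin n)} (h : IsPairContractive τ)
    {I : Finset (Fin n)} (hI : I.Nonempty) {x : ℝ} (hx : 0 < x) :
    ∃ δ > 0, ∀ η, 0 ≤ η → η < δ → ∀ t₀ θ, IsPerturbedTrajectory τ η t₀ θ →
      (∀ i ∈ I, x ≤ θ t₀ i) → ∀ᶠ t in atTop, VIE I hI (θ t) ≤ x := by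
  obtain ⟨ρ, hρ0, hρ⟩ : ∃ ρ : ℝ, 0 < ρ ∧ n * ρ < (1 / 2) ^ n :=
    ⟨(1 / 2) ^ n / (n + 1), by positivity, by
      rw [mul_div_assoc', div_lt_iff₀ (by positivity)]
      have : (0 : ℝ) < (1 / 2) ^ n := by positivity
      linarith⟩
  have h1 := eventually_all.2 fun i => h.eventually_forall_le_coord i hx hρ0 hρ
  have h2 := eventually_all.2 fun i => eventually_all.2 fun j =>
    h.eventually_forall_coord_le_mul i j hx hρ0
  obtain ⟨δ, hδ, hsub⟩ := mem_nhdsGE_iff_exists_Ico_subset.1 (h1.and h2)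
  refine ⟨δ, hδ, fun η hη0 hηδ t₀ θ hθ hx₀ => ?_⟩
  obtain ⟨hcoord, hratio⟩ := hsub ⟨hη0, hηδ⟩
  have hge : ∀ᶠ t in atTop, ∀ i ∈ I, ρ ≤ θ t i :=
    (Finset.eventually_all I).2 fun i hi => hcoord i t₀ θ hθ (hx₀ i hi)
  obtain ⟨T, hT⟩ := eventually_atTop.1 (hge.and (eventually_ge_atTop t₀))
  have hθT := hθ.mono (hT T le_rfl).2
  have hle : ∀ᶠ t in atTop, ∀ i ∈ I, ∀ j ∈ I, θ t i ≤ (1 + x) * θ t j :=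
    (Finset.eventually_all I).2 fun i _ => (Finset.eventually_all I).2 fun j hj =>
      hratio i j T θ hθT fun t ht => (hT t ht).1 j hj
  filter_upwards [hge, hle] with t ht ht'
  exact VIE_le_of_forall_le_mul hI hx.le (fun i hi => hρ0.trans_le (ht i hi)) ht'

/-- Averaging the coordinates in `I` moves `θ` by at most `n * V_I(θ)`. -/
theorem infDist_omegaLowE_zero_le {n : ℕ} {I : Finset (Fin n)} (hI : I.Nonempty)
    {θ : EuclideanSpace ℝ (Fin n)} (hθ : θ ∈ simplexE n) :
    Metric.infDist θ (OmegaLowE I hI 0) ≤ n * VIE I hI θ := by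
  set S := ∑ k ∈ I, θ k with hS
  have hcard : (0 : ℝ) < I.card := by exact_mod_cast hI.card_pos
  let y : EuclideanSpace ℝ (Fin n) := WithLp.toLp 2 fun k => if k ∈ I then S / I.card else θ k
  have hS0 : 0 ≤ S := Finset.sum_nonneg fun k _ => hθ.1 k
  have hS1 : S ≤ 1 := by
    rw [← hθ.2]
    exact Finset.sum_le_sum_of_subset_of_nonneg (Finset.subset_univ I) fun k _ _ => hθ.1 k
  have hyI : ∀ k ∈ I, y k = S / I.card := fun k hk => if_pos hk
  have hyIc : ∀ k ∉ I, y k = θ k := fun k hk => if_neg hk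
  have hy : y ∈ simplexE n := by
    refine ⟨fun k => ?_, ?_⟩
    · by_cases hk : k ∈ I
      · rw [hyI k hk]; positivity
      · rw [hyIc k hk]; exact hθ.1 k
    · rw [← hθ.2, ← Finset.sum_add_sum_compl I, ← Finset.sum_add_sum_compl I fun k => θ k,
        Finset.sum_congr rfl hyI,
        Finset.sum_congr rfl fun k hk => hyIc k (Finset.mem_compl.1 hk), Finset.sum_const,
        nsmul_eq_mul, mul_div_cancel₀ _ hcard.ne']
  have hyV : VIE I hI y ≤ 0 := by
    rw [VIE, sub_nonpos, Finset.sup'_le_iff]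
    intro i hi
    rw [Finset.le_inf'_iff]
    intro j hj
    rw [hyI i hi, hyI j hj]
  have hV0 : 0 ≤ VIE I hI θ := by
    obtain ⟨i, hi⟩ := id hI
    exact sub_nonneg.2 ((Finset.inf'_le (fun k => θ k / S) hi).trans
      (Finset.le_sup' (fun k => θ k / S) hi))
  have hpair : ∀ i ∈ I, ∀ j ∈ I, θ i - θ j ≤ VIE I hI θ := by
    intro i hi j hj
    have h1 : θ i / S ≤ _ := Finset.le_sup' (fun k => θ k / S) hi
    have h2 : _ ≤ θ j / S := Finset.inf'_le (fun k => θ k / S) hj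
    have h3 : θ i / S - θ j / S ≤ VIE I hI θ := sub_le_sub h1 h2
    rw [← sub_div] at h3
    rcases hS0.eq_or_lt with h0 | h0
    · have hz := (Finset.sum_eq_zero_iff_of_nonneg fun k _ => hθ.1 k).1 h0.symm
      rw [hz i hi, hz j hj] at h3 ⊢
      simpa using h3
    · rw [div_le_iff₀ h0] at h3
      nlinarith
  have hdist : ∀ k, |θ k - y k| ≤ VIE I hI θ := by
    intro k
    by_cases hk : k ∈ I
    swap
    · simpa [hyIc k hk] using hV0
    have hsum1 : ∑ j ∈ I, (θ k - θ j) ≤ I.card * VIE I hI θ := by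
      simpa using Finset.sum_le_sum fun j hj => hpair k hk j hj
    have hsum2 : ∑ j ∈ I, (θ j - θ k) ≤ I.card * VIE I hI θ := by
      simpa using Finset.sum_le_sum fun j hj => hpair j hj k hk
    simp only [Finset.sum_sub_distrib, Finset.sum_const, nsmul_eq_mul, ← hS] at hsum1 hsum2
    have hmul : I.card * (S / I.card) = S := mul_div_cancel₀ _ hcard.ne'
    rw [hyI k hk, abs_le]
    constructor
    · refine le_of_mul_le_mul_left ?_ hcard
      linarith
    · refine le_of_mul_le_mul_left ?_ hcard
      linarith
  calc Metric.infDist θ (OmegaLowE I hI 0) ≤ dist θ y := Metric.infDist_le_dist_of_mem ⟨hy, hyV⟩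
    _ ≤ ∑ k, |θ k - y k| := by
      rw [EuclideanSpace.dist_eq]
      exact Real.sqrt_le_iff.2 ⟨Finset.sum_nonneg fun k _ => abs_nonneg _,
        Finset.sum_sq_le_sq_sum_of_nonneg fun k _ => abs_nonneg _⟩
    _ ≤ n * VIE I hI θ := by
      simpa using Finset.sum_le_sum fun k (_ : k ∈ Finset.univ) => hdist k

end

/-- High temperature leads to uniformity (ODE version): if `τ : Δⁿ → Δⁿ` is continuous,
order preserving and contractive, then for every nonempty index set `I` there exist `η̄ > 0`
and a class-K function `κ` on `[0, η̄)` such that every (Carathéodory, i.e. integral-form)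
solution of `θ' = τ(θ) − θ + ε` with `‖ε‖ ≤ η < η̄` that starts outside `Ω̄_I(κ(η))`
converges to `Ω̲_I(κ(η))`. -/
theorem high_temperature_ode_convergence {n : ℕ}
    (τ : EuclideanSpace ℝ (Fin n) → EuclideanSpace ℝ (Fin n))
    (hτmap : ∀ θ ∈ simplexE n, τ θ ∈ simplexE n)
    (hτcont : ContinuousOn τ (simplexE n))
    (hτord : ∀ θ ∈ simplexE n, ∀ i j : Fin n,
      (θ i < θ j → τ θ i < τ θ j) ∧ (θ i = θ j → τ θ i = τ θ j))
    (hτcontr : ∀ θ ∈ simplexE n, ∀ (J : Finset (Fin n)) (hJ : J.Nonempty),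
      0 < J.inf' hJ (fun i => θ i) → J.inf' hJ (fun i => θ i) < J.sup' hJ (fun i => θ i) →
        VIE J hJ (τ θ) < VIE J hJ θ)
    (I : Finset (Fin n)) (hI : I.Nonempty) :
    ∃ ηbar > (0 : ℝ), ∃ κ : ℝ → ℝ,
      (ContinuousOn κ (Set.Ico 0 ηbar) ∧ StrictMonoOn κ (Set.Ico 0 ηbar) ∧ κ 0 = 0 ∧
        ∀ x ∈ Set.Ico (0 : ℝ) ηbar, 0 ≤ κ x) ∧
      ∀ η ∈ Set.Ico (0 : ℝ) ηbar, ∀ t₀ : ℝ,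
        ∀ ε : ℝ → EuclideanSpace ℝ (Fin n), Measurable ε → (∀ t, t₀ ≤ t → ‖ε t‖ ≤ η) →
        ∀ θ : ℝ → EuclideanSpace ℝ (Fin n),
          ContinuousOn θ (Set.Ici t₀) →
          (∀ t, t₀ ≤ t → θ t ∈ simplexE n) →
          (∀ t, t₀ ≤ t → θ t = θ t₀ + ∫ s in t₀..t, (τ (θ s) - θ s + ε s)) →
          θ t₀ ∉ OmegaHighE I hI (κ η) →
          Tendsto (fun t => Metric.infDist (θ t) (OmegaLowE I hI (κ η))) atTop (nhds 0) := by
  have hτ := IsPairContractive.of_contractive hτmap hτcont hτord hτcontr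
  obtain ⟨ηbar, hηbar, κ, hκ, hP⟩ := exists_classK_of_forall_pos
    (fun η x => ∀ t₀ θ, IsPerturbedTrajectory τ η t₀ θ → (∀ i ∈ I, x ≤ θ t₀ i) →
      ∀ᶠ t in atTop, VIE I hI (θ t) ≤ x)
    (fun η x y hxy h t₀ θ hθ hy => (h t₀ θ hθ fun i hi => hxy.trans (hy i hi)).mono
      fun t ht => ht.trans hxy)
    (fun x hx => hτ.exists_forall_eventually_VIE_le hI hx)
  refine ⟨ηbar, hηbar, κ, hκ, ?_⟩
  intro η hη t₀ ε hε hεη θ hcont hmem hint hstart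
  have htraj := IsPerturbedTrajectory.of_integral_eq hτcont hε hεη hcont hmem hint
  have hmin : κ η < I.inf' hI fun i => θ t₀ i := by
    by_contra! hle
    exact hstart ⟨hmem t₀ le_rfl, hle⟩
  rcases hη.1.eq_or_lt with rfl | hpos
  · rw [hκ.2.2.1] at hmin ⊢
    have hV : ∀ x > 0, ∀ᶠ t in atTop, VIE I hI (θ t) ≤ x := by
      intro x hx
      set y := min x (I.inf' hI fun i => θ t₀ i)
      obtain ⟨δ, hδ, h⟩ := hτ.exists_forall_eventually_VIE_le hI (lt_min hx hmin)
      exact (h 0 le_rfl hδ t₀ θ htraj fun i hi =>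
        (min_le_right _ _).trans (Finset.inf'_le _ hi)).mono fun t ht => ht.trans (min_le_left _ _)
    rw [Metric.tendsto_nhds]
    intro e he
    have hn : (0 : ℝ) < n + 1 := by positivity
    filter_upwards [hV (e / (n + 1)) (div_pos he hn), eventually_ge_atTop t₀] with t ht ht₀
    rw [Real.dist_eq, sub_zero, abs_of_nonneg Metric.infDist_nonneg]
    have hle := infDist_omegaLowE_zero_le hI (hmem t ht₀)
    have hlt : n * (e / (n + 1)) < e := by
      rw [mul_div_assoc', div_lt_iff₀ hn]
      linarith
    have := mul_le_mul_of_nonneg_left ht (Nat.cast_nonneg (α := ℝ) n)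
    linarith
  · refine tendsto_const_nhds.congr' ?_
    filter_upwards [hP η hpos hη.2 t₀ θ htraj fun i hi =>
      hmin.le.trans (Finset.inf'_le _ hi), eventually_ge_atTop t₀] with t ht ht₀
    exact (Metric.infDist_zero_of_mem (s := OmegaLowE I hI (κ η)) ⟨hmem t ht₀, ht⟩).symm
end
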